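/- arXiv:2312.03145 — 5 statements merged into one kernel-verified Lean document; each statement's English description precedes it below -/
import Mathlib

section
/- Let S be a p×p real symmetric positive semidefinite matrix that is singular (det S = 0). Then the infimum of the function K ↦ Tr(S K) − log(det K) over the set of p×p real symmetric positive definite matrices is −∞; in particular no minimizer exists. -/
open Matrix

/-- A rank-one perturbation of the identity along a kernel vector of `S` leaves `Tr(S K)` fixed. -/
lemma trace_mul_one_add_smul_vecMulVec_of_mulVec_eq_zero {n R : Type*} [Fintype n] [DecidableEq n]
    [CommRing R] {S : Matrix n n R} {v : n → R} (hv : S *ᵥ v = 0) (t : R) (w : n → R) :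
    (S * (1 + t • vecMulVec v w)).trace = S.trace := by
  rw [Matrix.mul_add, Matrix.mul_smul, mul_vecMulVec, hv]
  simp

lemma det_one_add_smul_vecMulVec {n R : Type*} [Fintype n] [DecidableEq n] [CommRing R]
    (t : R) (v w : n → R) :
    (1 + t • vecMulVec v w).det = 1 + t * (w ⬝ᵥ v) := by
  rw [← smul_vecMulVec, vecMulVec_eq Unit, det_one_add_replicateCol_mul_replicateRow,
    dotProduct_smul, smul_eq_mul]

lemma posDef_one_add_smul_vecMulVec_self {n : Type*} [Fintype n] [DecidableEq n]
    {t : ℝ} (ht : 0 ≤ t) (v : n → ℝ) : (1 + t • vecMulVec v v).PosDef := by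
  have h : (vecMulVec v v).PosSemidef := by simpa using posSemidef_vecMulVec_self_star v
  exact PosDef.one.add_posSemidef (h.smul ht)

lemma exists_posDef_trace_sub_log_det_lt {n : Type*} [Fintype n] [DecidableEq n]
    {S : Matrix n n ℝ} (hsing : S.det = 0) (c : ℝ) :
    ∃ K : Matrix n n ℝ, K.PosDef ∧ (S * K).trace - Real.log K.det < c := by
  obtain ⟨v, hv0, hv⟩ := exists_mulVec_eq_zero_iff.mpr hsing
  have hpos : 0 < v ⬝ᵥ v := by simpa using dotProduct_star_self_pos_iff.mpr hv0
  set L := |S.trace - c| + 1 with hL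
  have hL0 : 0 ≤ L := by positivity
  have ht : 0 ≤ (Real.exp L - 1) / (v ⬝ᵥ v) :=
    div_nonneg (sub_nonneg.mpr (Real.one_le_exp hL0)) hpos.le
  refine ⟨1 + ((Real.exp L - 1) / (v ⬝ᵥ v)) • vecMulVec v v,
    posDef_one_add_smul_vecMulVec_self ht v, ?_⟩
  rw [trace_mul_one_add_smul_vecMulVec_of_mulVec_eq_zero hv, det_one_add_smul_vecMulVec,
    div_mul_cancel₀ _ hpos.ne', add_sub_cancel, Real.log_exp]
  linarith [le_abs_self (S.trace - c)]

/-- If `S` is real symmetric positive semidefinite and singular, then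
`K ↦ Tr(S K) − log det K` is unbounded below on the set of real symmetric positive
definite matrices; in particular no minimizer exists. -/
theorem traceForm_unbounded_below_of_singular (p : ℕ)
    (S : Matrix (Fin p) (Fin p) ℝ) (hS : S.PosSemidef) (hsing : S.det = 0) :
    (∀ c : ℝ, ∃ K : Matrix (Fin p) (Fin p) ℝ, K.PosDef ∧
        (S * K).trace - Real.log K.det < c) ∧
    ¬ ∃ K : Matrix (Fin p) (Fin p) ℝ, K.PosDef ∧
        IsMinOn (fun K : Matrix (Fin p) (Fin p) ℝ => (S * K).trace - Real.log K.det)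
          {K : Matrix (Fin p) (Fin p) ℝ | K.PosDef} K := by
  refine ⟨exists_posDef_trace_sub_log_det_lt hsing, ?_⟩
  rintro ⟨K, -, hmin⟩
  obtain ⟨K', hK', hlt⟩ :=
    exists_posDef_trace_sub_log_det_lt hsing ((S * K).trace - Real.log K.det)
  exact (isMinOn_iff.mp hmin K' hK').not_gt hlt
end

section
/- Let G be a graph on vertex set {1,…,p} with edge set E, and let X ∈ ℝ^{p×n} be such that X Xᵀ is positive definite. Then the function K ↦ Tr(X Xᵀ K) − log(det K) attains a minimum on the Gaussian graphical model M_G := {K : K is a p×p real symmetric positive definite matrix and K_{ij} = 0 whenever i ≠ j and ij ∉ E}, and the minimizer is unique. -/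
open Matrix

/-- The Gaussian graphical model of a graph `G`: real symmetric positive definite matrices
whose off-diagonal entries vanish on non-edges of `G`. -/
def gaussianModel {p : ℕ} (G : SimpleGraph (Fin p)) : Set (Matrix (Fin p) (Fin p) ℝ) :=
  {K | K.PosDef ∧ ∀ i j : Fin p, i ≠ j → ¬ G.Adj i j → K i j = 0}

namespace Matrix

variable {m : Type*} [Fintype m]

/-- Conjugating by a factor of `W` turns `Tr (W * K)` into the trace of a positive matrix. -/
theorem trace_conj_eq {W B K : Matrix m m ℝ} (hB : W = Bᴴ * B) :
    (B * K * Bᴴ).trace = (W * K).trace := by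
  rw [trace_mul_cycle, hB]

theorem isClosed_setOf_posSemidef : IsClosed {K : Matrix m m ℝ | K.PosSemidef} := by
  simp only [posSemidef_iff_dotProduct_mulVec, Set.ofPred_and, Set.ofPred_forall, IsHermitian]
  refine (isClosed_eq (by fun_prop) continuous_id).inter (isClosed_iInter fun x => ?_)
  exact isClosed_le continuous_const (by fun_prop)

variable [DecidableEq m]

open scoped MatrixOrder Matrix.Norms.L2Operator in
/-- A positive definite matrix factors as `Bᴴ * B` with `B` invertible. -/
theorem PosDef.exists_isUnit_eq_conjTranspose_mul_self {W : Matrix m m ℝ} (hW : W.PosDef) :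
    ∃ B : Matrix m m ℝ, IsUnit B ∧ W = Bᴴ * B :=
  CStarAlgebra.isStrictlyPositive_iff_eq_star_mul_self.mp hW.isStrictlyPositive

theorem PosDef.log_det_eq_sum {M : Matrix m m ℝ} (hM : M.PosDef) :
    Real.log M.det = ∑ i, Real.log (hM.1.eigenvalues i) := by
  rw [hM.1.det_eq_prod_eigenvalues]
  exact Real.log_prod fun i _ => (hM.eigenvalues_pos i).ne'

theorem PosDef.log_det_le_trace_sub_card {M : Matrix m m ℝ} (hM : M.PosDef) :
    Real.log M.det ≤ M.trace - Fintype.card m := by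
  have h : M.trace - Fintype.card m = ∑ i, (hM.1.eigenvalues i - 1) := by
    simp [hM.1.trace_eq_sum_eigenvalues]
  rw [h, hM.log_det_eq_sum]
  exact Finset.sum_le_sum fun i _ => Real.log_le_sub_one_of_pos (hM.eigenvalues_pos i)

theorem PosDef.eq_one_of_log_det_eq {M : Matrix m m ℝ} (hM : M.PosDef)
    (heq : Real.log M.det = M.trace - Fintype.card m) : M = 1 := by
  have h : M.trace - Fintype.card m = ∑ i, (hM.1.eigenvalues i - 1) := by
    simp [hM.1.trace_eq_sum_eigenvalues]
  rw [h, hM.log_det_eq_sum, Finset.sum_eq_sum_iff_of_le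
    fun i _ => Real.log_le_sub_one_of_pos (hM.eigenvalues_pos i)] at heq
  have hone : hM.1.eigenvalues = fun _ => 1 := by
    funext i
    by_contra hne
    exact (Real.log_lt_sub_one_of_pos (hM.eigenvalues_pos i) hne).ne (heq i (Finset.mem_univ i))
  rw [hM.1.spectral_theorem, hone]
  have : diagonal ((RCLike.ofReal : ℝ → ℝ) ∘ fun _ : m => (1 : ℝ)) = 1 := by
    ext i j; simp [diagonal, one_apply]
  rw [this, map_one]

theorem PosDef.log_det_add_log_det_le {W K : Matrix m m ℝ} (hW : W.PosDef) (hK : K.PosDef) :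
    Real.log W.det + Real.log K.det ≤ (W * K).trace - Fintype.card m ∧
      (Real.log W.det + Real.log K.det = (W * K).trace - Fintype.card m → W * K = 1) := by
  obtain ⟨B, hu, hB⟩ := hW.exists_isUnit_eq_conjTranspose_mul_self
  have hM : (B * K * Bᴴ).PosDef := (IsUnit.posDef_star_right_conjugate_iff hu).mpr hK
  have hdet : Real.log W.det + Real.log K.det = Real.log (B * K * Bᴴ).det := by
    rw [← Real.log_mul hW.det_pos.ne' hK.det_pos.ne', hB]
    simp only [det_mul]
    ring_nf
  rw [hdet, ← trace_conj_eq hB]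
  refine ⟨hM.log_det_le_trace_sub_card, fun h => ?_⟩
  have h1 : B * (K * Bᴴ) = 1 := by rw [← mul_assoc, hM.eq_one_of_log_det_eq h]
  have h2 : K * (Bᴴ * B) = 1 := by rw [← mul_assoc, mul_eq_one_comm.mp h1]
  rw [hB, mul_eq_one_comm.mp h2]

theorem PosSemidef.abs_apply_le_trace {M : Matrix m m ℝ} (hM : M.PosSemidef) (i j : m) :
    |M i j| ≤ M.trace := by
  have hd : ∀ k, M k k ≤ M.trace := fun k =>
    Finset.single_le_sum (f := fun k => M k k) (fun l _ => hM.diag_nonneg) (Finset.mem_univ k)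
  have hsymm : M j i = M i j := by simpa using hM.1.apply i j
  have key : ∀ s : ℝ, 0 ≤ M i i + s * M i j + s * M j i + s * s * M j j := fun s => by
    have h := hM.dotProduct_mulVec_nonneg (Pi.single i 1 + s • Pi.single j 1)
    simp [mulVec_add, mulVec_smul, add_dotProduct, dotProduct_add] at h
    linarith
  have h1 := key 1
  have h2 := key (-1)
  have := hd i
  have := hd j
  rw [abs_le]
  constructor <;> linarith

theorem PosDef.trace_mul_nonneg {W K : Matrix m m ℝ} (hW : W.PosDef) (hK : K.PosSemidef) :
    0 ≤ (W * K).trace := by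
  obtain ⟨B, -, hB⟩ := hW.exists_isUnit_eq_conjTranspose_mul_self
  rw [← trace_conj_eq hB]
  exact (hK.mul_mul_conjTranspose_same B).trace_nonneg

/-- A trace bound against a positive definite matrix cuts out a compact set of
positive semidefinite matrices. -/
theorem PosDef.isCompact_setOf_trace_mul_le {W : Matrix m m ℝ} (hW : W.PosDef) (c : ℝ) :
    IsCompact {K : Matrix m m ℝ | K.PosSemidef ∧ (W * K).trace ≤ c} := by
  obtain ⟨B, hu, hB⟩ := hW.exists_isUnit_eq_conjTranspose_mul_self
  have hbox : IsCompact {M : Matrix m m ℝ | ∀ i j, M i j ∈ Set.Icc (-c) c} := by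
    have h : {M : Matrix m m ℝ | ∀ i j, M i j ∈ Set.Icc (-c) c} =
        Set.univ.pi fun _ : m => Set.univ.pi fun _ : m => Set.Icc (-c) c := by
      ext M
      exact ⟨fun h i _ j _ => h i j, fun h i j => h i trivial j trivial⟩
    rw [h]
    exact isCompact_univ_pi fun _ => isCompact_univ_pi fun _ => isCompact_Icc
  have hcont : Continuous fun M : Matrix m m ℝ => B⁻¹ * M * (Bᴴ)⁻¹ := by fun_prop
  have htrace : Continuous fun K : Matrix m m ℝ => (W * K).trace := by fun_prop
  refine (hbox.image hcont).of_isClosed_subset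
    (isClosed_setOf_posSemidef.inter (isClosed_le htrace continuous_const)) ?_
  rintro K ⟨hK, hc⟩
  have hdet : IsUnit B.det := (isUnit_iff_isUnit_det B).mp hu
  have hdet' : IsUnit Bᴴ.det := by simpa [det_conjTranspose] using hdet
  refine ⟨B * K * Bᴴ, fun i j => ?_, ?_⟩
  · rw [Set.mem_Icc, ← abs_le]
    refine ((hK.mul_mul_conjTranspose_same B).abs_apply_le_trace i j).trans ?_
    rwa [trace_conj_eq hB]
  · simp only [mul_assoc]
    rw [mul_nonsing_inv _ hdet', mul_one, nonsing_inv_mul_cancel_left _ _ hdet]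

end Matrix

/-- The Gaussian negative log-likelihood, up to constants. -/
noncomputable def gaussianNegLogLik {p : ℕ} (S K : Matrix (Fin p) (Fin p) ℝ) : ℝ :=
  (S * K).trace - Real.log K.det

theorem midpoint_mem_gaussianModel {p : ℕ} {G : SimpleGraph (Fin p)}
    {K K' : Matrix (Fin p) (Fin p) ℝ} (hK : K ∈ gaussianModel G) (hK' : K' ∈ gaussianModel G) :
    (1 / 2 : ℝ) • (K + K') ∈ gaussianModel G :=
  ⟨(hK.1.add hK'.1).smul (by norm_num), fun i j hij hG => by
    simp [hK.2 i j hij hG, hK'.2 i j hij hG]⟩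

theorem eq_of_isMinOn_gaussianNegLogLik {p : ℕ} {G : SimpleGraph (Fin p)}
    {S K K' : Matrix (Fin p) (Fin p) ℝ} (hK : K ∈ gaussianModel G) (hK' : K' ∈ gaussianModel G)
    (hmin : IsMinOn (gaussianNegLogLik S) (gaussianModel G) K)
    (hmin' : IsMinOn (gaussianNegLogLik S) (gaussianModel G) K') : K' = K := by
  have hL := midpoint_mem_gaussianModel hK hK'
  set L := (1 / 2 : ℝ) • (K + K') with hLdef
  have hsum : K + K' = (2 : ℝ) • L := by rw [hLdef, smul_smul]; norm_num
  have hdet : IsUnit L.det := hL.1.det_pos.ne'.isUnit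
  have h1 : gaussianNegLogLik S K ≤ gaussianNegLogLik S L := hmin hL
  have h2 : gaussianNegLogLik S K' ≤ gaussianNegLogLik S L := hmin' hL
  have e1 := hL.1.inv.log_det_add_log_det_le hK.1
  have e2 := hL.1.inv.log_det_add_log_det_le hK'.1
  have hlog : Real.log (L⁻¹).det = - Real.log L.det := by
    rw [det_nonsing_inv, Ring.inverse_eq_inv', Real.log_inv]
  have htr : (L⁻¹ * K).trace + (L⁻¹ * K').trace = 2 * p := by
    rw [← trace_add, ← mul_add, hsum, Matrix.mul_smul, nonsing_inv_mul _ hdet]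
    simp
  have hS : (S * K).trace + (S * K').trace = 2 * (S * L).trace := by
    rw [← trace_add, ← mul_add, hsum, Matrix.mul_smul, trace_smul, smul_eq_mul]
  simp only [gaussianNegLogLik] at h1 h2
  rw [hlog, Fintype.card_fin] at e1 e2
  have i1 : L⁻¹ * K = 1 := e1.2 (by linarith [e1.1, e2.1])
  have i2 : L⁻¹ * K' = 1 := e2.2 (by linarith [e1.1, e2.1])
  have := congrArg (L * ·) (i2.trans i1.symm)
  simpa [mul_nonsing_inv_cancel_left _ _ hdet] using this

theorem exists_isMinOn_gaussianNegLogLik {p : ℕ} (G : SimpleGraph (Fin p))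
    {S : Matrix (Fin p) (Fin p) ℝ} (hS : S.PosDef) :
    ∃ K ∈ gaussianModel G, IsMinOn (gaussianNegLogLik S) (gaussianModel G) K := by
  have hhalf : ((1 / 2 : ℝ) • S).PosDef := hS.smul (by norm_num)
  set c : ℝ := 2 * (S.trace - Real.log ((1 / 2 : ℝ) • S).det - p) with hc
  set C : Set (Matrix (Fin p) (Fin p) ℝ) :=
    {K | K.PosSemidef ∧ (S * K).trace ≤ c} ∩
      ({K | Real.exp (-S.trace) ≤ K.det} ∩
        {K | ∀ i j : Fin p, i ≠ j → ¬ G.Adj i j → K i j = 0})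
  have hpattern : IsClosed {K : Matrix (Fin p) (Fin p) ℝ |
      ∀ i j : Fin p, i ≠ j → ¬ G.Adj i j → K i j = 0} := by
    simp only [Set.ofPred_forall]
    exact isClosed_iInter fun i => isClosed_iInter fun j => isClosed_iInter fun _ =>
      isClosed_iInter fun _ => isClosed_eq (by fun_prop) continuous_const
  have hcomp : IsCompact C := (hS.isCompact_setOf_trace_mul_le c).inter_right
    ((isClosed_le continuous_const (by fun_prop)).inter hpattern)
  have hdet : ∀ K ∈ C, 0 < K.det := fun K hK => (Real.exp_pos _).trans_le hK.2.1
  have hsub : C ⊆ gaussianModel G := fun K hK =>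
    ⟨hK.1.1.posDef_iff_det_ne_zero.mpr (hdet K hK).ne', hK.2.2⟩
  have hone : (1 : Matrix (Fin p) (Fin p) ℝ) ∈ gaussianModel G :=
    ⟨PosDef.one, fun i j hij _ => one_apply_ne hij⟩
  have hval : gaussianNegLogLik S 1 = S.trace := by simp [gaussianNegLogLik]
  have hsublevel : ∀ K ∈ gaussianModel G, gaussianNegLogLik S K ≤ S.trace → K ∈ C := by
    intro K hK hle
    simp only [gaussianNegLogLik] at hle
    refine ⟨⟨hK.1.posSemidef, ?_⟩, ?_, hK.2⟩
    · have h := (hhalf.log_det_add_log_det_le hK.1).1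
      rw [Matrix.smul_mul, trace_smul, smul_eq_mul, Fintype.card_fin] at h
      rw [hc]
      linarith
    · have h := hS.trace_mul_nonneg hK.1.posSemidef
      exact (Real.le_log_iff_exp_le hK.1.det_pos).mp (by linarith)
  have hcont : ContinuousOn (gaussianNegLogLik S) C := by
    have h1 : Continuous fun K : Matrix (Fin p) (Fin p) ℝ => (S * K).trace := by fun_prop
    have h2 : Continuous fun K : Matrix (Fin p) (Fin p) ℝ => K.det := by fun_prop
    exact h1.continuousOn.sub (h2.continuousOn.log fun K hK => (hdet K hK).ne')
  have h1C := hsublevel 1 hone hval.le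
  obtain ⟨K, hKC, hmin⟩ := hcomp.exists_isMinOn ⟨1, h1C⟩ hcont
  refine ⟨K, hsub hKC, fun K' hK' => ?_⟩
  by_cases hle : gaussianNegLogLik S K' ≤ S.trace
  · exact hmin (hsublevel K' hK' hle)
  · exact ((hmin h1C).trans hval.le).trans (not_le.mp hle).le

/-- If `X Xᵀ` is positive definite then `K ↦ Tr(X Xᵀ K) − log det K` attains a minimum on
the Gaussian graphical model `M_G`, and the minimizer is unique. -/
theorem mle_exists_unique_of_posDef (p n : ℕ) (G : SimpleGraph (Fin p))
    (X : Matrix (Fin p) (Fin n) ℝ) (hX : (X * Xᵀ).PosDef) :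
    ∃ K ∈ gaussianModel G,
      IsMinOn (fun K : Matrix (Fin p) (Fin p) ℝ => (X * Xᵀ * K).trace - Real.log K.det)
        (gaussianModel G) K ∧
      ∀ K' ∈ gaussianModel G,
        IsMinOn (fun K : Matrix (Fin p) (Fin p) ℝ => (X * Xᵀ * K).trace - Real.log K.det)
          (gaussianModel G) K' → K' = K := by
  obtain ⟨K, hK, hmin⟩ := exists_isMinOn_gaussianNegLogLik G hX
  exact ⟨K, hK, hmin, fun K' hK' hmin' => eq_of_isMinOn_gaussianNegLogLik hK hK' hmin hmin'⟩
end

section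
/- Let G be a graph on vertex set {1,…,p} (with p ≥ 2) and edge set E. Then there exists X ∈ ℝ^{p×(p−1)} such that the rigidity matrix R_{p−1}^G(X) has rank equal to |E|. -/
open Matrix MeasureTheory

/-- The rigidity matrix `R_n^G(X)`: rows indexed by the edges of `G`, columns indexed by
`{1,…,p} × {1,…,n}`; the entry in row `e = ij` and column `(l,k)` is `X l k − X j k` if
`l = i`, is `X l k − X i k` if `l = j`, and is `0` otherwise. -/
noncomputable def rigidityMatrix {p n : ℕ} (G : SimpleGraph (Fin p)) [DecidableRel G.Adj]
    (X : Matrix (Fin p) (Fin n) ℝ) : Matrix G.edgeFinset (Fin p × Fin n) ℝ :=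
  fun e lk =>
    Sym2.lift
      ⟨fun i j =>
        ((if lk.1 = i then (1 : ℝ) else 0) - (if lk.1 = j then (1 : ℝ) else 0)) *
          (X i lk.2 - X j lk.2),
        fun i j => by ring⟩ (e : Sym2 (Fin p))

/-- The configuration placing vertex `0` at the origin and vertex `k + 1` at the `k`-th standard
basis vector: the vertices of the standard simplex. -/
noncomputable def simplexConfiguration (n : ℕ) : Matrix (Fin (n + 1)) (Fin n) ℝ :=
  fun i k => if i = k.succ then 1 else 0

/-- For the simplex configuration, the column `(l, k)` of the rigidity matrix is supported on the
edge joining `l` and `k + 1`. -/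
theorem rigidityMatrix_simplexConfiguration_apply {n : ℕ} (G : SimpleGraph (Fin (n + 1)))
    [DecidableRel G.Adj] (e : G.edgeFinset) {l : Fin (n + 1)} {k : Fin n} (hl : l ≠ k.succ) :
    rigidityMatrix G (simplexConfiguration n) e (l, k) =
      if (e : Sym2 (Fin (n + 1))) = s(l, k.succ) then -1 else 0 := by
  obtain ⟨e, he⟩ := e
  induction e using Sym2.ind with
  | _ a b =>
    have hab : a ≠ b := (G.mem_edgeSet.1 (SimpleGraph.mem_edgeFinset.1 he)).ne
    simp only [rigidityMatrix, simplexConfiguration, Sym2.lift_mk, Sym2.eq_iff]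
    grind

/-- The rows of the rigidity matrix of the simplex configuration are linearly independent. -/
theorem linearIndependent_rigidityMatrix_simplexConfiguration {n : ℕ}
    (G : SimpleGraph (Fin (n + 1))) [DecidableRel G.Adj] :
    LinearIndependent ℝ (rigidityMatrix G (simplexConfiguration n)).row := by
  rw [Fintype.linearIndependent_iff]
  intro g hg e
  obtain ⟨l, k, hl, he⟩ : ∃ (l : Fin (n + 1)) (k : Fin n), l ≠ k.succ ∧
      (e : Sym2 (Fin (n + 1))) = s(l, k.succ) := by
    obtain ⟨e, he⟩ := e
    induction e using Sym2.ind with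
    | _ a b =>
      have hab : a ≠ b := (G.mem_edgeSet.1 (SimpleGraph.mem_edgeFinset.1 he)).ne
      rcases Fin.eq_zero_or_eq_succ b with rfl | ⟨k, rfl⟩
      · obtain ⟨k, rfl⟩ := Fin.exists_succ_eq.2 hab
        exact ⟨0, k, hab.symm, Sym2.eq_swap⟩
      · exact ⟨a, k, hab, rfl⟩
  have h := congrFun hg (l, k)
  simpa [Finset.sum_apply, Matrix.row, rigidityMatrix_simplexConfiguration_apply G _ hl, ← he,
    Subtype.coe_inj] using h

/-- For any graph `G` on `p ≥ 2` vertices there exists `X ∈ ℝ^{p×(p−1)}` such that the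
rigidity matrix `R_{p−1}^G(X)` has rank `|E|`. -/
theorem rigidityMatrix_full_rank_in_dim_p_sub_one (p : ℕ) (hp : 2 ≤ p)
    (G : SimpleGraph (Fin p)) [DecidableRel G.Adj] :
    ∃ X : Matrix (Fin p) (Fin (p - 1)) ℝ,
      (rigidityMatrix G X).rank = G.edgeFinset.card := by
  obtain ⟨n, rfl⟩ : ∃ n, p = n + 1 := ⟨p - 1, by omega⟩
  refine ⟨simplexConfiguration n, ?_⟩
  exact (linearIndependent_rigidityMatrix_simplexConfiguration G).rank_matrix.trans
    (Fintype.card_coe _)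
end

section
/- (Uhler; Gross–Sullivant: MLT ≤ GCR) Let G be a graph on vertex set {1,…,p} with edge set E, and let n ≥ 2 be an integer. Suppose there exists X_0 ∈ ℝ^{p×(n−1)} such that the rigidity matrix R_{n−1}^G(X_0) has rank |E|. Then for Lebesgue-almost every X ∈ ℝ^{p×n}, the function K ↦ Tr(X Xᵀ K) − log(det K) attains a minimum on the Gaussian graphical model M_G. -/
open Matrix MeasureTheory

open Filter Topology

/-- The zero set of a real analytic function on a finite-dimensional space that is not
identically zero is a null set for any Haar measure. -/
theorem AnalyticOnNhd.measure_zeroSet_eq_zero {E : Type*} [NormedAddCommGroup E]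
    [NormedSpace ℝ E] [FiniteDimensional ℝ E] [MeasurableSpace E] [BorelSpace E]
    (μ : Measure E) [μ.IsAddHaarMeasure] {f : E → ℝ} (hf : AnalyticOnNhd ℝ f Set.univ)
    {x₀ : E} (hx₀ : f x₀ ≠ 0) : μ {x | f x = 0} = 0 := by
  have hcont : Continuous f := by
    simpa [continuousOn_univ] using hf.continuousOn
  have hline : ∀ x : E, ∀ᵐ t : ℝ, f (AffineMap.homothety x₀ t x) ≠ 0 := by
    intro x
    have hg : AnalyticOnNhd ℝ (fun t : ℝ => f (AffineMap.homothety x₀ t x)) Set.univ := by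
      intro t _
      refine (hf _ (Set.mem_univ _)).comp ?_
      simp only [AffineMap.homothety_apply, vsub_eq_sub, vadd_eq_add]
      fun_prop
    have hcod := hg.preimage_zero_mem_codiscrete (x := 0) (by simpa using hx₀)
    have := ae_restrict_le_codiscreteWithin (μ := (volume : Measure ℝ)) MeasurableSet.univ hcod
    rw [Measure.restrict_univ] at this
    filter_upwards [this] with t ht
    simpa using ht
  have hswap : ∀ᵐ t : ℝ, ∀ᵐ x ∂μ, f (AffineMap.homothety x₀ t x) ≠ 0 := by
    refine (Measure.ae_ae_comm ?_).1 (Eventually.of_forall hline)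
    have hc : Continuous fun q : E × ℝ => f (AffineMap.homothety x₀ q.2 q.1) := by
      simp only [AffineMap.homothety_apply, vsub_eq_sub, vadd_eq_add]
      fun_prop
    exact (isClosed_singleton.preimage hc).isOpen_compl.measurableSet
  have hne : ∀ᵐ t : ℝ, t ≠ 0 := by simp [ae_iff]
  obtain ⟨t, ht, ht0⟩ := (hswap.and hne).exists
  have hnull : μ {x | f (AffineMap.homothety x₀ t x) = 0} = 0 := by
    simpa [ae_iff] using ht
  refine measure_mono_null (t := AffineMap.homothety x₀ t ''
    {x | f (AffineMap.homothety x₀ t x) = 0}) ?_ ?_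
  · intro x hx
    have : AffineMap.homothety x₀ t (AffineMap.homothety x₀ t⁻¹ x) = x := by
      rw [← AffineMap.homothety_mul_apply, mul_inv_cancel₀ ht0]
      simp
    exact ⟨AffineMap.homothety x₀ t⁻¹ x, by simpa [this] using hx, this⟩
  · rw [Measure.addHaar_image_homothety, hnull, mul_zero]

/-- The rigidity matrix in homogeneous coordinates, column `0` of `X` being the homogenizing
coordinate. -/
noncomputable def homogeneousRigidityMatrix {p m : ℕ} (G : SimpleGraph (Fin p))
    [DecidableRel G.Adj] (X : Fin p → Fin (m + 1) → ℝ) :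
    Matrix G.edgeFinset (Fin p × Fin m) ℝ :=
  fun e lk =>
    Sym2.lift
      ⟨fun i j =>
        ((if lk.1 = i then (1 : ℝ) else 0) - (if lk.1 = j then (1 : ℝ) else 0)) *
          (X i lk.2.succ * X j 0 - X j lk.2.succ * X i 0),
        fun i j => by ring⟩ (e : Sym2 (Fin p))

theorem homogeneousRigidityMatrix_cons_one {p m : ℕ} (G : SimpleGraph (Fin p))
    [DecidableRel G.Adj] (X : Matrix (Fin p) (Fin m) ℝ) :
    homogeneousRigidityMatrix G (fun i => Fin.cons 1 (X i)) = rigidityMatrix G X := by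
  ext e lk
  obtain ⟨e, he⟩ := e
  induction e using Sym2.ind with
  | _ i j => simp [homogeneousRigidityMatrix, rigidityMatrix]

theorem analyticAt_homogeneousRigidityMatrix {p m : ℕ} (G : SimpleGraph (Fin p))
    [DecidableRel G.Adj] (e : G.edgeFinset) (lk : Fin p × Fin m)
    (X : Fin p → Fin (m + 1) → ℝ) :
    AnalyticAt ℝ (fun Y => homogeneousRigidityMatrix G Y e lk) X := by
  obtain ⟨e, he⟩ := e
  have hcoord : ∀ i k, AnalyticAt ℝ (fun Y : Fin p → Fin (m + 1) → ℝ => Y i k) X :=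
    fun i k => ((ContinuousLinearMap.proj (R := ℝ) (φ := fun _ : Fin (m + 1) => ℝ) k).comp
      (ContinuousLinearMap.proj (R := ℝ) (φ := fun _ : Fin p => Fin (m + 1) → ℝ) i)).analyticAt X
  induction e using Sym2.ind with
  | _ i j =>
    simp only [homogeneousRigidityMatrix, Sym2.lift_mk]
    exact analyticAt_const.mul
      (((hcoord _ _).mul (hcoord _ _)).sub ((hcoord _ _).mul (hcoord _ _)))

/-- A matrix supported on `G` that annihilates `X` is a stress, hence vanishes when the
homogeneous rigidity matrix has independent rows. -/
theorem eq_zero_of_mul_eq_zero_of_det_ne_zero {p m : ℕ} (G : SimpleGraph (Fin p))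
    [DecidableRel G.Adj] {X : Fin p → Fin (m + 1) → ℝ}
    (hdet : (homogeneousRigidityMatrix G X * (homogeneousRigidityMatrix G X)ᵀ).det ≠ 0)
    (hX : ∀ i, X i 0 ≠ 0) {K : Matrix (Fin p) (Fin p) ℝ} (hK : K.IsSymm)
    (hsupp : ∀ i j, i ≠ j → ¬ G.Adj i j → K i j = 0) (hKX : K * Matrix.of X = 0) :
    K = 0 := by
  have hsum : ∀ l k, ∑ j, K l j * X j k = 0 := fun l k => by
    simpa [Matrix.mul_apply] using congrFun (congrFun hKX l) k
  let w : Sym2 (Fin p) → ℝ := Sym2.lift ⟨fun i j => K i j, fun i j => (hK.apply i j).symm⟩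
  have hw : (fun e : G.edgeFinset => w e) ᵥ* homogeneousRigidityMatrix G X = 0 := by
    ext ⟨l, k⟩
    have hedges : ∑ j ∈ G.neighborFinset l, K l j * (X l k.succ * X j 0 - X j k.succ * X l 0) =
        ∑ e ∈ G.edgeFinset, w e * Sym2.lift
          ⟨fun i j => ((if l = i then (1 : ℝ) else 0) - (if l = j then (1 : ℝ) else 0)) *
            (X i k.succ * X j 0 - X j k.succ * X i 0), fun i j => by ring⟩ e := by
      refine Finset.sum_of_injOn (fun j => s(l, j)) ?_ ?_ ?_ ?_
      · intro a _ b _ hab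
        exact Sym2.congr_right.1 hab
      · intro j hj
        simpa using hj
      · intro e he hne
        induction e using Sym2.ind with
        | _ i j =>
          have hadj : G.Adj i j := by simpa using he
          have hi : l ≠ i := by
            rintro rfl
            exact hne ⟨j, by simpa using hadj, rfl⟩
          have hj : l ≠ j := by
            rintro rfl
            exact hne ⟨i, by simpa using hadj.symm, Sym2.eq_swap⟩
          simp [hi, hj]
      · intro j hj
        have hne : l ≠ j := G.ne_of_adj (by simpa using hj)
        simp [w, hne]
    have hall : ∑ j ∈ G.neighborFinset l, K l j * (X l k.succ * X j 0 - X j k.succ * X l 0) =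
        ∑ j, K l j * (X l k.succ * X j 0 - X j k.succ * X l 0) := by
      refine Finset.sum_subset (Finset.subset_univ _) fun j _ hj => ?_
      rcases eq_or_ne l j with rfl | hne
      · ring
      · rw [hsupp l j hne (by simpa using hj), zero_mul]
    have hzero : ∑ j, K l j * (X l k.succ * X j 0 - X j k.succ * X l 0) = 0 := by
      calc _ = X l k.succ * ∑ j, K l j * X j 0 - X l 0 * ∑ j, K l j * X j k.succ := by
            rw [Finset.mul_sum, Finset.mul_sum, ← Finset.sum_sub_distrib]
            exact Finset.sum_congr rfl fun j _ => by ring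
        _ = 0 := by rw [hsum, hsum]; ring
    rw [hall, hzero] at hedges
    rw [← Finset.sum_coe_sort] at hedges
    exact hedges.symm
  have hw0 : (fun e : G.edgeFinset => w e) = 0 := by
    refine Matrix.eq_zero_of_vecMul_eq_zero hdet ?_
    rw [← Matrix.vecMul_vecMul, hw, Matrix.zero_vecMul]
  have hoff : ∀ i j, i ≠ j → K i j = 0 := by
    intro i j hij
    by_cases hadj : G.Adj i j
    · exact congrFun hw0 ⟨s(i, j), by simpa using hadj⟩
    · exact hsupp i j hij hadj
  ext i j
  rcases eq_or_ne i j with rfl | hij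
  · have := hsum i 0
    rw [Finset.sum_eq_single i (fun j _ hj => by rw [hoff i j hj.symm, zero_mul])
      (by simp)] at this
    exact (mul_eq_zero.1 this).resolve_right (hX i)
  · exact hoff i j hij

/-- If the rigidity matrix of `G` has independent rows at some point, then for almost every `X`
only the zero symmetric matrix supported on `G` annihilates `X`. -/
theorem ae_eq_zero_of_mul_eq_zero {p m : ℕ} (G : SimpleGraph (Fin p)) [DecidableRel G.Adj]
    {X₀ : Matrix (Fin p) (Fin m) ℝ} (h : (rigidityMatrix G X₀).rank = G.edgeFinset.card) :
    ∀ᵐ X : Fin p → Fin (m + 1) → ℝ, ∀ K : Matrix (Fin p) (Fin p) ℝ, K.IsSymm →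
      (∀ i j, i ≠ j → ¬ G.Adj i j → K i j = 0) → K * Matrix.of X = 0 → K = 0 := by
  let f : (Fin p → Fin (m + 1) → ℝ) → ℝ := fun X =>
    (homogeneousRigidityMatrix G X * (homogeneousRigidityMatrix G X)ᵀ).det * ∏ i, X i 0
  have hf : AnalyticOnNhd ℝ f Set.univ := by
    intro X _
    have hcoord : ∀ i, AnalyticAt ℝ (fun Y : Fin p → Fin (m + 1) → ℝ => Y i 0) X :=
      fun i => ((ContinuousLinearMap.proj (R := ℝ) (φ := fun _ : Fin (m + 1) => ℝ) 0).comp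
        (ContinuousLinearMap.proj (R := ℝ)
          (φ := fun _ : Fin p => Fin (m + 1) → ℝ) i)).analyticAt X
    refine AnalyticAt.mul ?_ (Finset.analyticAt_fun_prod _ fun i _ => hcoord i)
    simp only [Matrix.det_apply', Matrix.mul_apply, Matrix.transpose_apply]
    exact Finset.analyticAt_fun_sum _ fun σ _ => analyticAt_const.mul <|
      Finset.analyticAt_fun_prod _ fun e _ => Finset.analyticAt_fun_sum _ fun lk _ =>
        (analyticAt_homogeneousRigidityMatrix G _ _ X).mul
          (analyticAt_homogeneousRigidityMatrix G _ _ X)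
  have hne : f (fun i => Fin.cons 1 (X₀ i)) ≠ 0 := by
    simp only [f, homogeneousRigidityMatrix_cons_one, Fin.cons_zero, Finset.prod_const_one,
      mul_one]
    have hrank : (rigidityMatrix G X₀ * (rigidityMatrix G X₀)ᵀ).rank =
        Fintype.card G.edgeFinset := by
      rw [Matrix.rank_self_mul_transpose, h, Fintype.card_coe]
    have hrows := Matrix.linearIndependent_rows_iff_isUnit.1
      (linearIndependent_iff_card_eq_finrank_span.2
        (hrank.symm.trans (Matrix.rank_eq_finrank_span_row _)))
    exact ((Matrix.isUnit_iff_isUnit_det _).1 hrows).ne_zero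
  have hnull : ∀ᵐ X, f X ≠ 0 := by
    simpa [ae_iff] using AnalyticOnNhd.measure_zeroSet_eq_zero volume hf hne
  filter_upwards [hnull] with X hX K hK hsupp hKX
  have hX' := mul_ne_zero_iff.1 hX
  exact eq_zero_of_mul_eq_zero_of_det_ne_zero G hX'.1
    (fun i => Finset.prod_ne_zero_iff.1 hX'.2 i (Finset.mem_univ i)) hK hsupp hKX

/-- Each entry of a real positive semidefinite matrix is bounded by the trace. -/
theorem Matrix.PosSemidef.abs_apply_le_trace_s12 {ι : Type*} [Fintype ι]
    {K : Matrix ι ι ℝ} (hK : K.PosSemidef) (i j : ι) : |K i j| ≤ K.trace := by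
  classical
  have hle : ∀ l, K l l ≤ K.trace := fun l =>
    Finset.single_le_sum (f := fun l => K l l) (fun l _ => hK.diag_nonneg) (Finset.mem_univ l)
  have hsymm : K j i = K i j := by simpa using hK.isHermitian.apply i j
  have h₁ := hK.dotProduct_mulVec_nonneg (Pi.single i 1 + Pi.single j 1)
  have h₂ := hK.dotProduct_mulVec_nonneg (Pi.single i 1 - Pi.single j 1)
  simp [Matrix.mulVec_add, Matrix.mulVec_sub, hsymm] at h₁ h₂
  rw [abs_le]
  constructor <;> linarith [hle i, hle j]

/-- If `X Xᵀ` pairs to zero with a positive semidefinite matrix, that matrix annihilates `X`. -/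
theorem Matrix.PosSemidef.mul_eq_zero_of_trace_mul_eq_zero {ι κ : Type*} [Fintype ι] [Fintype κ]
    {K : Matrix ι ι ℝ} (hK : K.PosSemidef) {X : Matrix ι κ ℝ}
    (h : (X * Xᵀ * K).trace = 0) : K * X = 0 := by
  classical
  have hpsd : (Xᵀ * K * X).PosSemidef := by
    simpa using hK.conjTranspose_mul_mul_same X
  have hzero : Xᵀ * K * X = 0 := by
    rw [← hpsd.trace_eq_zero_iff, Matrix.mul_assoc, Matrix.trace_mul_comm, Matrix.mul_assoc,
      Matrix.trace_mul_comm, h]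
  ext i k
  have hk : star (X.col k) ⬝ᵥ K *ᵥ X.col k = 0 := by
    have := congrFun (congrFun hzero k) k
    rw [Matrix.mul_assoc] at this
    exact this
  exact congrFun ((hK.dotProduct_mulVec_zero_iff _).1 hk) i

theorem Matrix.PosSemidef.trace_mul_transpose_mul_nonneg {ι κ : Type*} [Fintype ι] [Fintype κ]
    {K : Matrix ι ι ℝ} (hK : K.PosSemidef) (X : Matrix ι κ ℝ) :
    0 ≤ (X * Xᵀ * K).trace := by
  have := (hK.conjTranspose_mul_mul_same X).trace_nonneg
  rwa [Matrix.conjTranspose_eq_transpose_of_trivial, Matrix.trace_mul_comm,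
    ← Matrix.mul_assoc] at this

/-- Linear upper bound for `log det`, of arbitrarily small slope. -/
theorem Matrix.PosDef.log_det_le {ι : Type*} [Fintype ι] [DecidableEq ι]
    {K : Matrix ι ι ℝ} (hK : K.PosDef) {c : ℝ} (hc : 0 < c) :
    Real.log K.det ≤ c * K.trace - Fintype.card ι * (1 + Real.log c) := by
  have hpos := hK.eigenvalues_pos
  rw [hK.isHermitian.det_eq_prod_eigenvalues, hK.isHermitian.trace_eq_sum_eigenvalues]
  simp only [RCLike.ofReal_real_eq_id, id]
  rw [Real.log_prod fun i _ => (hpos i).ne', Finset.mul_sum]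
  have : ∀ i, Real.log (hK.isHermitian.eigenvalues i) ≤
      c * hK.isHermitian.eigenvalues i - (1 + Real.log c) := fun i => by
    have := Real.log_le_sub_one_of_pos (mul_pos hc (hpos i))
    rw [Real.log_mul hc.ne' (hpos i).ne'] at this
    linarith
  calc _ ≤ ∑ i, (c * hK.isHermitian.eigenvalues i - (1 + Real.log c)) :=
        Finset.sum_le_sum fun i _ => this i
    _ = _ := by simp [Finset.sum_sub_distrib, mul_add]

/-- The positive semidefinite matrices supported on `G`. -/
def semidefiniteModel {p : ℕ} (G : SimpleGraph (Fin p)) : Set (Matrix (Fin p) (Fin p) ℝ) :=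
  {K | K.PosSemidef ∧ ∀ i j : Fin p, i ≠ j → ¬ G.Adj i j → K i j = 0}

theorem isClosed_semidefiniteModel {p : ℕ} (G : SimpleGraph (Fin p)) :
    IsClosed (semidefiniteModel G) := by
  have : semidefiniteModel G = {K | Kᴴ = K} ∩
      (⋂ x : Fin p → ℝ, {K | 0 ≤ star x ⬝ᵥ (K *ᵥ x)}) ∩
      ⋂ i, ⋂ j, {K | i ≠ j → ¬ G.Adj i j → K i j = 0} := by
    ext K
    simp [semidefiniteModel, Matrix.posSemidef_iff_dotProduct_mulVec, Matrix.IsHermitian]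
  rw [this]
  refine ((isClosed_eq (by fun_prop) continuous_id).inter
    (isClosed_iInter fun x => isClosed_le continuous_const (by fun_prop))).inter
    (isClosed_iInter fun i => isClosed_iInter fun j => ?_)
  simp only [Set.ofPred_forall]
  exact isClosed_iInter fun _ => isClosed_iInter fun _ =>
    isClosed_eq (by fun_prop) continuous_const

theorem isCompact_semidefiniteModel_trace_le {p : ℕ} (G : SimpleGraph (Fin p)) (T : ℝ) :
    IsCompact (semidefiniteModel G ∩ {K | K.trace ≤ T}) := by
  have hbox : IsCompact (Set.univ.pi fun _ : Fin p => Set.univ.pi fun _ : Fin p =>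
      Set.Icc (-T) T) :=
    isCompact_univ_pi fun _ => isCompact_univ_pi fun _ => isCompact_Icc
  refine IsCompact.of_isClosed_subset (X := Matrix (Fin p) (Fin p) ℝ) hbox
    ((isClosed_semidefiniteModel G).inter (isClosed_le (by fun_prop) continuous_const)) ?_
  rintro K ⟨⟨hK, -⟩, hT⟩ i - j -
  exact abs_le.1 ((hK.abs_apply_le_trace_s12 i j).trans hT)

/-- If no nonzero positive semidefinite matrix supported on `G` annihilates `X`, then
`K ↦ Tr(X Xᵀ K)` is coercive on the positive semidefinite matrices supported on `G`. -/
theorem exists_mul_trace_le {p n : ℕ} (G : SimpleGraph (Fin p)) {X : Matrix (Fin p) (Fin n) ℝ}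
    (hX : ∀ K ∈ semidefiniteModel G, K * X = 0 → K = 0) :
    ∃ c > 0, ∀ K ∈ semidefiniteModel G, c * K.trace ≤ (X * Xᵀ * K).trace := by
  have hcpt : IsCompact (semidefiniteModel G ∩ {K | K.trace ≤ 1} ∩ {K | K.trace = 1}) :=
    (isCompact_semidefiniteModel_trace_le G 1).inter_right
      (isClosed_eq (by fun_prop) continuous_const)
  obtain ⟨c, hc, hmin⟩ := hcpt.exists_forall_le' (f := fun K => (X * Xᵀ * K).trace) (a := 0)
    (by fun_prop) (by
      rintro K ⟨⟨hK, -⟩, h₁⟩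
      refine (hK.1.trace_mul_transpose_mul_nonneg X).lt_of_ne' fun h₀ => ?_
      have := hX K hK (hK.1.mul_eq_zero_of_trace_mul_eq_zero h₀)
      simp [this] at h₁)
  refine ⟨c, hc, fun K hK => ?_⟩
  rcases hK.1.trace_nonneg.eq_or_lt' with h₀ | hpos
  · simp [hK.1.trace_eq_zero_iff.1 h₀]
  · have htr : (K.trace⁻¹ • K).trace = 1 := by
      rw [Matrix.trace_smul, smul_eq_mul, inv_mul_cancel₀ hpos.ne']
    have := hmin (K.trace⁻¹ • K) ⟨⟨⟨hK.1.smul (inv_nonneg.2 hpos.le), fun i j hij hadj => by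
      simp [hK.2 i j hij hadj]⟩, htr.le⟩, htr⟩
    rw [Matrix.mul_smul, Matrix.trace_smul, smul_eq_mul, inv_mul_eq_div, le_div_iff₀ hpos] at this
    exact this

theorem exists_isMinOn_gaussianModel {p n : ℕ} (G : SimpleGraph (Fin p))
    {X : Matrix (Fin p) (Fin n) ℝ} (hX : ∀ K ∈ semidefiniteModel G, K * X = 0 → K = 0) :
    ∃ K ∈ gaussianModel G, IsMinOn (fun K : Matrix (Fin p) (Fin p) ℝ =>
      (X * Xᵀ * K).trace - Real.log K.det) (gaussianModel G) K := by
  obtain ⟨c, hc, hcoer⟩ := exists_mul_trace_le G hX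
  set f : Matrix (Fin p) (Fin p) ℝ → ℝ := fun K => (X * Xᵀ * K).trace - Real.log K.det
  have hone : (1 : Matrix (Fin p) (Fin p) ℝ) ∈ gaussianModel G :=
    ⟨Matrix.PosDef.one, fun i j hij _ => Matrix.one_apply_ne hij⟩
  have hsub : ∀ K ∈ gaussianModel G, K ∈ semidefiniteModel G :=
    fun K hK => ⟨hK.1.posSemidef, hK.2⟩
  obtain ⟨T, hT⟩ : ∃ T, ∀ K ∈ gaussianModel G, f K ≤ f 1 → K.trace ≤ T := by
    refine ⟨(f 1 - Fintype.card (Fin p) * (1 + Real.log (c / 2))) / (c / 2), fun K hK hle => ?_⟩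
    rw [le_div_iff₀ (half_pos hc)]
    have h₁ := hcoer K (hsub K hK)
    have h₂ := hK.1.log_det_le (half_pos hc)
    have h₃ : f K = (X * Xᵀ * K).trace - Real.log K.det := rfl
    linarith
  have hdet : ∀ K ∈ gaussianModel G, f K ≤ f 1 → Real.exp (-f 1) ≤ K.det := by
    intro K hK hle
    rw [← Real.le_log_iff_exp_le hK.1.det_pos]
    have h₁ := hK.1.posSemidef.trace_mul_transpose_mul_nonneg X
    have h₃ : f K = (X * Xᵀ * K).trace - Real.log K.det := rfl
    linarith
  set C : Set (Matrix (Fin p) (Fin p) ℝ) :=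
    semidefiniteModel G ∩ {K | K.trace ≤ T} ∩ {K | Real.exp (-f 1) ≤ K.det}
  have hC : IsCompact C := (isCompact_semidefiniteModel_trace_le G T).inter_right
    (isClosed_le continuous_const (by fun_prop))
  have hmem : ∀ K ∈ gaussianModel G, f K ≤ f 1 → K ∈ C :=
    fun K hK hle => ⟨⟨hsub K hK, hT K hK hle⟩, hdet K hK hle⟩
  have hpos : ∀ K ∈ C, 0 < K.det := fun K hK => (Real.exp_pos _).trans_le hK.2
  have hcont : ContinuousOn f C := by
    refine ContinuousOn.sub (by fun_prop) (ContinuousOn.log (by fun_prop) fun K hK =>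
      (hpos K hK).ne')
  obtain ⟨K, hK, hmin⟩ := hC.exists_isMinOn ⟨1, hmem 1 hone le_rfl⟩ hcont
  have hKpd : K.PosDef := hK.1.1.1.posDef_iff_isUnit.2
    ((Matrix.isUnit_iff_isUnit_det K).2 (hpos K hK).ne'.isUnit)
  refine ⟨K, ⟨hKpd, hK.1.1.2⟩, fun L hL => ?_⟩
  rcases le_total (f L) (f 1) with hle | hle
  · exact hmin (hmem L hL hle)
  · exact (hmin (hmem 1 hone le_rfl)).trans hle

/-- (Uhler; Gross–Sullivant: MLT ≤ GCR.) If the rigidity matrix `R_{n−1}^G` achieves rank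
`|E|` at some `X₀`, then for almost every `X ∈ ℝ^{p×n}` the MLE exists, i.e.
`K ↦ Tr(X Xᵀ K) − log det K` attains a minimum on `M_G`. -/
theorem mlt_le_gcr (p n : ℕ) (hn : 2 ≤ n)
    (G : SimpleGraph (Fin p)) [DecidableRel G.Adj]
    (h : ∃ X₀ : Matrix (Fin p) (Fin (n - 1)) ℝ,
      (rigidityMatrix G X₀).rank = G.edgeFinset.card) :
    volume {X : Fin p → Fin n → ℝ | ¬ ∃ K ∈ gaussianModel G,
      IsMinOn (fun K : Matrix (Fin p) (Fin p) ℝ =>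
          (Matrix.of X * (Matrix.of X)ᵀ * K).trace - Real.log K.det)
        (gaussianModel G) K} = 0 := by
  obtain ⟨m, rfl⟩ : ∃ m, n = m + 1 := ⟨n - 1, by omega⟩
  obtain ⟨X₀, hX₀⟩ := h
  refine ae_iff.1 ?_
  filter_upwards [ae_eq_zero_of_mul_eq_zero G (m := m) hX₀] with X hX
  exact exists_isMinOn_gaussianModel G fun K hK hKX =>
    hX K (by simpa using hK.1.isHermitian) hK.2 hKX
end

section
/- (Buhl's clique-number lower bound) Let G be a graph on vertex set {1,…,p} with edge set E, and suppose G contains a clique on k vertices. Let n be a positive integer with n < k. Then for Lebesgue-almost every X ∈ ℝ^{p×n}, the function K ↦ Tr(X Xᵀ K) − log(det K) does not attain a minimum on the Gaussian graphical model M_G. -/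
open Matrix MeasureTheory

/-- A symmetric rank-one update by a nonzero vector strictly increases the determinant of a
positive definite matrix. -/
theorem Matrix.PosDef.det_lt_det_add_vecMulVec {ι : Type*} [Fintype ι] [DecidableEq ι]
    {K : Matrix ι ι ℝ} (hK : K.PosDef) {v : ι → ℝ} (hv : v ≠ 0) :
    K.det < (K + vecMulVec v v).det := by
  have hpos : 0 < v ⬝ᵥ (K⁻¹ *ᵥ v) := by
    simpa using hK.inv.dotProduct_mulVec_pos hv
  have hunit : IsUnit K.det := hK.det_pos.ne'.isUnit
  rw [vecMulVec_eq Unit, det_add_replicateCol_mul_replicateRow hunit]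
  have hscalar : (replicateRow Unit v * K⁻¹ * replicateCol Unit v).det = v ⬝ᵥ (K⁻¹ *ᵥ v) := by
    rw [det_unique, Matrix.mul_assoc, ← replicateCol_mulVec]
    rfl
  have hdet : (1 + replicateRow Unit v * K⁻¹ * replicateCol Unit v).det
      = 1 + v ⬝ᵥ (K⁻¹ *ᵥ v) := by
    rw [← hscalar, det_unique, det_unique, Matrix.add_apply, one_apply_eq]
  rw [hdet]
  nlinarith [mul_pos hK.det_pos hpos]

/-- If a set of row indices is larger than the number of columns, some nonzero vector supported
on it is a left null vector of the matrix. -/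
theorem Matrix.exists_vecMul_eq_zero_of_card_lt {ι κ : Type*} [Fintype ι] [Fintype κ]
    (A : Matrix ι κ ℝ) (s : Finset ι) (hs : Fintype.card κ < s.card) :
    ∃ v : ι → ℝ, v ≠ 0 ∧ (∀ i ∉ s, v i = 0) ∧ v ᵥ* A = 0 := by
  classical
  have hker := LinearMap.ker_ne_bot_of_finrank_lt
    (f := (A.submatrix ((↑) : s → ι) id).vecMulLinear) (by simpa using hs)
  obtain ⟨w, hw, hw0⟩ := Submodule.exists_mem_ne_zero_of_ne_bot hker
  refine ⟨fun i => if h : i ∈ s then w ⟨i, h⟩ else 0, ?_, fun i hi => dif_neg hi, ?_⟩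
  · contrapose! hw0
    ext ⟨i, hi⟩
    simpa [hi] using congrFun hw0 i
  · ext j
    have hj := congrFun (LinearMap.mem_ker.mp hw) j
    simp only [vecMulLinear_apply, vecMul, dotProduct, submatrix_apply, id, Pi.zero_apply] at hj ⊢
    rw [← Finset.sum_subset s.subset_univ (fun i _ hi => by simp [hi]), ← Finset.sum_coe_sort s]
    simpa using hj

/-- The Gaussian graphical model is stable under adding `v vᵀ` for `v` supported on a clique. -/
theorem add_vecMulVec_mem_gaussianModel {p : ℕ} {G : SimpleGraph (Fin p)} {s : Finset (Fin p)}
    (hs : G.IsClique s) {K : Matrix (Fin p) (Fin p) ℝ} (hK : K ∈ gaussianModel G)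
    {v : Fin p → ℝ} (hv : ∀ i ∉ s, v i = 0) : K + vecMulVec v v ∈ gaussianModel G := by
  refine ⟨hK.1.add_posSemidef ?_, fun i j hij hG => ?_⟩
  · simpa using posSemidef_vecMulVec_self_star v
  · rw [Matrix.add_apply, hK.2 i j hij hG, vecMulVec_apply, zero_add]
    by_cases hi : i ∈ s
    · have hj : j ∉ s := fun hj => hG (hs hi hj hij)
      rw [hv j hj, mul_zero]
    · rw [hv i hi, zero_mul]

/-- (Buhl's clique-number lower bound.) If `G` contains a clique on `k` vertices and
`n < k`, then for almost every `X ∈ ℝ^{p×n}` the function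
`K ↦ Tr(X Xᵀ K) − log det K` does not attain a minimum on `M_G`. -/
theorem clique_lower_bound_mlt (p n k : ℕ) (hn : 0 < n) (hnk : n < k)
    (G : SimpleGraph (Fin p)) (s : Finset (Fin p)) (hs : G.IsNClique k s) :
    volume {X : Fin p → Fin n → ℝ | ∃ K ∈ gaussianModel G,
      IsMinOn (fun K : Matrix (Fin p) (Fin p) ℝ =>
          (Matrix.of X * (Matrix.of X)ᵀ * K).trace - Real.log K.det)
        (gaussianModel G) K} = 0 := by
  refine measure_mono_null (t := ∅) ?_ measure_empty
  rintro X ⟨K, hK, hmin⟩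
  obtain ⟨v, hv0, hvs, hvX⟩ := (Matrix.of X).exists_vecMul_eq_zero_of_card_lt s
    (by simpa [hs.card_eq] using hnk)
  have hle := hmin (add_vecMulVec_mem_gaussianModel hs.isClique hK hvs)
  have htrace : (Matrix.of X * (Matrix.of X)ᵀ * vecMulVec v v).trace = 0 := by
    rw [Matrix.mul_assoc, mul_vecMulVec, mulVec_transpose, hvX]
    simp
  have hlog := Real.log_lt_log hK.1.det_pos (hK.1.det_lt_det_add_vecMulVec hv0)
  simp only [Set.mem_ofPred_eq, Matrix.mul_add, trace_add, htrace] at hle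
  linarith
end
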